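/- The assignment a∧b∧c∧d ↦ (a∧b)·(c∧d) − (a∧c)·(b∧d) + (a∧d)·(b∧c) defines a well-defined injective group homomorphism w from Λ⁴H into S²Λ²H. -/

import Mathlib

/-!
STATEMENT 2: For a finitely generated free abelian group `H`, the assignment
`a∧b∧c∧d ↦ (a∧b)·(c∧d) − (a∧c)·(b∧d) + (a∧d)·(b∧c)` defines a well-defined injective
group homomorphism `w : Λ⁴H → S²Λ²H`.
-/

open TensorProduct

set_option synthInstance.maxHeartbeats 1000000
set_option maxHeartbeats 1000000

variable (H : Type) [AddCommGroup H] [Module ℤ H]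

/-- The second exterior power `Λ²H` of `H` over `ℤ`. -/
abbrev Lambda2 : Submodule ℤ (ExteriorAlgebra ℤ H) := ⋀[ℤ]^2 H

/-- The fourth exterior power `Λ⁴H` of `H` over `ℤ`. -/
abbrev Lambda4 : Submodule ℤ (ExteriorAlgebra ℤ H) := ⋀[ℤ]^4 H

/-- The wedge product `a ∧ b` as an element of `Λ²H`. -/
noncomputable def wedge (a b : H) : Lambda2 H :=
  ⟨ExteriorAlgebra.ιMulti ℤ 2 ![a, b],
    ExteriorAlgebra.ιMulti_range ℤ 2 (Set.mem_range_self _)⟩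

/-- The wedge product `a ∧ b ∧ c ∧ d` as an element of `Λ⁴H`. -/
noncomputable def wedge4 (a b c d : H) : Lambda4 H :=
  ⟨ExteriorAlgebra.ιMulti ℤ 4 ![a, b, c, d],
    ExteriorAlgebra.ιMulti_range ℤ 4 (Set.mem_range_self _)⟩

/-- The tensor product `Λ²H ⊗ Λ²H` over `ℤ`. -/
abbrev TT := (Lambda2 H) ⊗[ℤ] (Lambda2 H)

/-- The submodule of `Λ²H ⊗ Λ²H` generated by the elements `x⊗y - y⊗x`. -/
noncomputable def symRel : Submodule ℤ (TT H) :=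
  Submodule.span ℤ {z : TT H | ∃ x y : Lambda2 H, z = x ⊗ₜ[ℤ] y - y ⊗ₜ[ℤ] x}

/-- The second symmetric power `S²Λ²H`: quotient of `Λ²H ⊗ Λ²H` by all `x⊗y - y⊗x`. -/
abbrev Sym2L := TT H ⧸ symRel H

/-- The product `x·y` in `S²Λ²H`, i.e. the class of `x ⊗ y`. -/
noncomputable def symProd (x y : Lambda2 H) : Sym2L H :=
  Submodule.Quotient.mk (x ⊗ₜ[ℤ] y)


lemma s2_wedge_coe (a b : H) :
    (wedge H a b : ExteriorAlgebra ℤ H) = ExteriorAlgebra.ι ℤ a * ExteriorAlgebra.ι ℤ b := by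
  simp [wedge, ExteriorAlgebra.ιMulti_apply]

lemma s2_wedge4_coe (a b c d : H) :
    (wedge4 H a b c d : ExteriorAlgebra ℤ H) = ExteriorAlgebra.ι ℤ a * (ExteriorAlgebra.ι ℤ b *
      (ExteriorAlgebra.ι ℤ c * ExteriorAlgebra.ι ℤ d)) := by
  simp [wedge4, ExteriorAlgebra.ιMulti_apply]

lemma s2_wedge_add_left (a a' b : H) : wedge H (a + a') b = wedge H a b + wedge H a' b := by
  apply Subtype.ext; simp [s2_wedge_coe, add_mul]

lemma s2_wedge_add_right (a b b' : H) : wedge H a (b + b') = wedge H a b + wedge H a b' := by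
  apply Subtype.ext; simp [s2_wedge_coe, mul_add]

lemma s2_wedge_smul_left (n : ℤ) (a b : H) : wedge H (n • a) b = n • wedge H a b := by
  let f : H →+ Lambda2 H := AddMonoidHom.mk' (fun a => wedge H a b)
    (fun a a' => s2_wedge_add_left H a a' b)
  have h := map_zsmul f n a
  exact h

lemma s2_wedge_smul_right (n : ℤ) (a b : H) : wedge H a (n • b) = n • wedge H a b := by
  let f : H →+ Lambda2 H := AddMonoidHom.mk' (fun b => wedge H a b)
    (fun b b' => s2_wedge_add_right H a b b')
  have h := map_zsmul f n b
  exact h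

lemma s2_wedge_self (a : H) : wedge H a a = 0 := by
  apply Subtype.ext; simp [s2_wedge_coe]

lemma s2_iota_swap (a b : H) : ExteriorAlgebra.ι ℤ a * ExteriorAlgebra.ι ℤ b =
    -(ExteriorAlgebra.ι ℤ b * ExteriorAlgebra.ι ℤ a) :=
  eq_neg_of_add_eq_zero_left (ExteriorAlgebra.ι_add_mul_swap a b)

lemma s2_wedge_swap (a b : H) : wedge H a b = - wedge H b a := by
  apply Subtype.ext
  rw [Submodule.coe_neg, s2_wedge_coe, s2_wedge_coe, s2_iota_swap]

lemma s2_symProd_add_left (x x' y : Lambda2 H) :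
    symProd H (x + x') y = symProd H x y + symProd H x' y := by
  simp only [symProd, TensorProduct.add_tmul, Submodule.Quotient.mk_add]

lemma s2_symProd_add_right (x y y' : Lambda2 H) :
    symProd H x (y + y') = symProd H x y + symProd H x y' := by
  simp only [symProd, TensorProduct.tmul_add, Submodule.Quotient.mk_add]

lemma s2_symProd_smul_left (n : ℤ) (x y : Lambda2 H) :
    symProd H (n • x) y = n • symProd H x y :=
  map_zsmul (AddMonoidHom.mk' (fun x => symProd H x y)
    (fun x x' => s2_symProd_add_left H x x' y)) n x

lemma s2_symProd_comm (x y : Lambda2 H) : symProd H x y = symProd H y x := by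
  unfold symProd
  rw [Submodule.Quotient.eq]
  exact Submodule.subset_span ⟨x, y, rfl⟩

lemma s2_symProd_smul_right (n : ℤ) (x y : Lambda2 H) :
    symProd H x (n • y) = n • symProd H x y := by
  rw [s2_symProd_comm, s2_symProd_smul_left, s2_symProd_comm]

lemma s2_symProd_zero_left (y : Lambda2 H) : symProd H 0 y = 0 := by
  have := s2_symProd_smul_left H 0 0 y
  simpa using this

lemma s2_symProd_zero_right (y : Lambda2 H) : symProd H y 0 = 0 := by
  rw [s2_symProd_comm, s2_symProd_zero_left]

lemma s2_symProd_neg_left (x y : Lambda2 H) : symProd H (-x) y = - symProd H x y := by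
  have := s2_symProd_smul_left H (-1) x y
  simpa using this

lemma s2_symProd_neg_right (x y : Lambda2 H) : symProd H x (-y) = - symProd H x y := by
  rw [s2_symProd_comm, s2_symProd_neg_left, s2_symProd_comm]

/-- The defining expression of `w`. -/
noncomputable def s2F (a b c d : H) : Sym2L H :=
  symProd H (wedge H a b) (wedge H c d) - symProd H (wedge H a c) (wedge H b d)
            + symProd H (wedge H a d) (wedge H b c)

lemma s2F_aab (a c d : H) : s2F H a a c d = 0 := by
  unfold s2F
  rw [s2_wedge_self, s2_symProd_zero_left, s2_symProd_comm H (wedge H a d)]; abel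

lemma s2F_swap12 (a b c d : H) : s2F H b a c d = - s2F H a b c d := by
  unfold s2F
  rw [s2_wedge_swap H b a, s2_symProd_neg_left, s2_symProd_comm H (wedge H b d),
    s2_symProd_comm H (wedge H b c)]; abel

lemma s2F_swap23 (a b c d : H) : s2F H a c b d = - s2F H a b c d := by
  unfold s2F
  rw [s2_wedge_swap H c b, s2_symProd_neg_right]; abel

lemma s2F_swap34 (a b c d : H) : s2F H a b d c = - s2F H a b c d := by
  unfold s2F
  rw [s2_wedge_swap H d c, s2_symProd_neg_right]; abel

lemma s2F_aba (a b d : H) : s2F H a b a d = 0 := by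
  rw [s2F_swap23, s2F_aab, neg_zero]

lemma s2F_abca (a b c : H) : s2F H a b c a = 0 := by
  rw [s2F_swap34, s2F_aba, neg_zero]

lemma s2F_abb (a b d : H) : s2F H a b b d = 0 := by
  rw [s2F_swap12, s2F_aba, neg_zero]

lemma s2F_abcb (a b c : H) : s2F H a b c b = 0 := by
  rw [s2F_swap12, s2F_abca, neg_zero]

lemma s2F_abcc (a b c : H) : s2F H a b c c = 0 := by
  rw [s2F_swap23, s2F_abcb, neg_zero]

/-- The alternating map inducing `w`. -/
noncomputable def s2Alt : H [⋀^Fin 4]→ₗ[ℤ] Sym2L H where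
  toFun v := s2F H (v 0) (v 1) (v 2) (v 3)
  map_update_add' := by
    intro inst v i x y
    obtain rfl : inst = instDecidableEqFin 4 := Subsingleton.elim _ _
    fin_cases i <;>
    simp [s2F, s2_wedge_add_left, s2_wedge_add_right, s2_symProd_add_left,
      s2_symProd_add_right] <;> abel
  map_update_smul' := by
    intro inst v i n x
    obtain rfl : inst = instDecidableEqFin 4 := Subsingleton.elim _ _
    have hs : (letI := (‹Module ℤ H›).toDistribMulAction.toMulAction.toSMul; n • x) =
      n • x :=
      int_smul_eq_zsmul ‹Module ℤ H› n x
    rw [hs]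
    fin_cases i <;>
    simp [s2F, s2_wedge_smul_left, s2_wedge_smul_right,
      s2_symProd_smul_left, s2_symProd_smul_right, smul_add, smul_sub]
  map_eq_zero_of_eq' := by
    intro v i j h hij
    fin_cases i <;> fin_cases j <;> simp at h hij <;>
    simp [h, s2F_aab, s2F_aba, s2F_abca, s2F_abb, s2F_abcb, s2F_abcc]

lemma s2_comm_aux {R M : Type} [CommRing R] [AddCommGroup M] [Module R M]
    (x y : ExteriorAlgebra R M) (hx : x ∈ ⋀[R]^2 M) (hy : y ∈ ⋀[R]^2 M) : x * y = y * x := by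
  have key : ∀ a b c : M, ExteriorAlgebra.ι R a * ExteriorAlgebra.ι R b * ExteriorAlgebra.ι R c
      = ExteriorAlgebra.ι R c * (ExteriorAlgebra.ι R a * ExteriorAlgebra.ι R b) := by
    intro a b c
    have sw : ∀ a b : M, ExteriorAlgebra.ι R a * ExteriorAlgebra.ι R b =
      -(ExteriorAlgebra.ι R b * ExteriorAlgebra.ι R a) := fun a b =>
        eq_neg_of_add_eq_zero_left (ExteriorAlgebra.ι_add_mul_swap a b)
    rw [mul_assoc, sw b c, mul_neg, ← mul_assoc, sw a c, neg_mul, neg_neg, mul_assoc]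
  rw [← ExteriorAlgebra.ιMulti_span_fixedDegree] at hx hy
  induction hx using Submodule.span_induction with
  | mem u hu =>
    obtain ⟨v, rfl⟩ := hu
    induction hy using Submodule.span_induction with
    | mem u hu =>
      obtain ⟨v', rfl⟩ := hu
      simp only [ExteriorAlgebra.ιMulti_apply, List.ofFn_succ, List.ofFn_zero, List.prod_cons,
        List.prod_nil, mul_one]
      rw [← mul_assoc, key, mul_assoc, key, mul_assoc]
    | zero => simp
    | add _ _ _ _ h1 h2 => rw [mul_add, add_mul, h1, h2]
    | smul n _ _ h => rw [mul_smul_comm, smul_mul_assoc, h]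
  | zero => simp
  | add _ _ _ _ h1 h2 => rw [mul_add, add_mul, h1, h2]
  | smul n _ _ h => rw [mul_smul_comm, smul_mul_assoc, h]

lemma s2_comm (x y : Lambda2 H) :
    (x : ExteriorAlgebra ℤ H) * (y : ExteriorAlgebra ℤ H) = y * x :=
  s2_comm_aux _ _ x.2 y.2

/-- Multiplication `Λ²H ⊗ Λ²H → ΛH`. -/
noncomputable def s2MulT : TT H →ₗ[ℤ] ExteriorAlgebra ℤ H :=
  TensorProduct.lift (LinearMap.mk₂ ℤ
    (fun x y : Lambda2 H => (x : ExteriorAlgebra ℤ H) * (y : ExteriorAlgebra ℤ H))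
    (fun x x' y => add_mul (x : ExteriorAlgebra ℤ H) x' y)
    (fun n x y => smul_mul_assoc n (x : ExteriorAlgebra ℤ H) (y : ExteriorAlgebra ℤ H))
    (fun x y y' => mul_add (x : ExteriorAlgebra ℤ H) y y')
    (fun n x y => mul_smul_comm n (x : ExteriorAlgebra ℤ H) (y : ExteriorAlgebra ℤ H)))

lemma s2MulT_tmul (x y : Lambda2 H) :
    s2MulT H (x ⊗ₜ[ℤ] y) = (x : ExteriorAlgebra ℤ H) * y := rfl

/-- Multiplication `S²Λ²H → ΛH`. -/
noncomputable def s2Mul : Sym2L H →ₗ[ℤ] ExteriorAlgebra ℤ H :=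
  (symRel H).liftQ (s2MulT H) (by
    unfold symRel
    rw [Submodule.span_le]
    rintro z ⟨x, y, rfl⟩
    change s2MulT H (x ⊗ₜ[ℤ] y - y ⊗ₜ[ℤ] x) = 0
    rw [map_sub, s2MulT_tmul, s2MulT_tmul, s2_comm H x y, sub_self])

lemma s2Mul_symProd (x y : Lambda2 H) :
    s2Mul H (symProd H x y) = (x : ExteriorAlgebra ℤ H) * y := rfl

/-- Additive maps out of `Λ⁴H` agreeing on decomposables are equal. -/
lemma s2_ext {N : Type} [AddCommGroup N] (f g : Lambda4 H →+ N)
    (h : ∀ a b c d, f (wedge4 H a b c d) = g (wedge4 H a b c d)) : f = g := by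
  have : f.toIntLinearMap = g.toIntLinearMap := by
    apply exteriorPower.linearMap_ext
    ext v
    have hv : ![v 0, v 1, v 2, v 3] = v := by
      ext i; fin_cases i <;> rfl
    have h1 := h (v 0) (v 1) (v 2) (v 3)
    unfold wedge4 at h1
    simp only [hv] at h1
    exact h1
  ext x
  exact LinearMap.congr_fun this x

/-- The homomorphism `w`. -/
noncomputable def s2W : Lambda4 H →+ Sym2L H :=
  (exteriorPower.alternatingMapLinearEquiv (s2Alt H)).toAddMonoidHom

lemma s2W_wedge4 (a b c d : H) : s2W H (wedge4 H a b c d) = s2F H a b c d :=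
  exteriorPower.alternatingMapLinearEquiv_apply_ιMulti (s2Alt H) ![a, b, c, d]

lemma s2Mul_F (a b c d : H) :
    s2Mul H (s2F H a b c d) = (3 : ℤ) • (wedge4 H a b c d : ExteriorAlgebra ℤ H) := by
  have e1 : (wedge H a c : ExteriorAlgebra ℤ H) * wedge H b d = - wedge4 H a b c d := by
    rw [s2_wedge_coe, s2_wedge_coe, s2_wedge4_coe, mul_assoc,
      ← mul_assoc (ExteriorAlgebra.ι ℤ c), s2_iota_swap H c b]
    simp only [neg_mul, mul_neg, mul_assoc]
  have e2 : (wedge H a d : ExteriorAlgebra ℤ H) * wedge H b c = wedge4 H a b c d := by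
    rw [s2_wedge_coe, s2_wedge_coe, s2_wedge4_coe, mul_assoc,
      ← mul_assoc (ExteriorAlgebra.ι ℤ d), s2_iota_swap H d b, neg_mul, mul_assoc,
      s2_iota_swap H d c]
    simp only [mul_neg, neg_neg]
  have e0 : (wedge H a b : ExteriorAlgebra ℤ H) * wedge H c d = wedge4 H a b c d := by
    rw [s2_wedge_coe, s2_wedge_coe, s2_wedge4_coe, mul_assoc]
  unfold s2F
  rw [map_add, map_sub, s2Mul_symProd, s2Mul_symProd, s2Mul_symProd, e0, e1, e2]
  module

theorem statement2 [Module.Free ℤ H] [Module.Finite ℤ H] :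
    ∃ w : Lambda4 H →+ Sym2L H,
      (∀ a b c d : H,
        w (wedge4 H a b c d) =
          symProd H (wedge H a b) (wedge H c d) - symProd H (wedge H a c) (wedge H b d)
            + symProd H (wedge H a d) (wedge H b c)) ∧
      Function.Injective w := by
  refine ⟨s2W H, s2W_wedge4 H, ?_⟩
  have h3 : (s2Mul H).toAddMonoidHom.comp (s2W H) =
      (3 : ℤ) • (Lambda4 H).subtype.toAddMonoidHom := by
    apply s2_ext
    intro a b c d
    have := s2Mul_F H a b c d
    rw [← s2W_wedge4] at this
    exact this
  rw [injective_iff_map_eq_zero]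
  intro x hx
  have h4 : s2Mul H (s2W H x) = (3 : ℤ) • (x : ExteriorAlgebra ℤ H) := DFunLike.congr_fun h3 x
  rw [hx, map_zero] at h4
  have h : (3 : ℤ) • x = 0 := Subtype.ext h4.symm
  have : Module.Free ℤ (Lambda4 H) := exteriorPower.instFree ℤ 4
  exact (smul_eq_zero.mp h).resolve_left (by norm_num)
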